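/- arXiv:2102.09856 — 2 statements merged into one kernel-verified Lean document; each statement's English description precedes it below -/
import Mathlib

section
/- Let a, b ∈ ℕ with a ≤ b, let A be the sum of a mutually independent ±1 uniform random variables and B the sum of b further such variables, all mutually independent. Let X ~ Bin(a,1/2), Y ~ Bin(b,1/2) be independent and Z ~ Bin(a+b,1/2). Then P(|A| < |B|) ≥ 1/2 − P(2Z = a+b) + P(2X = a)·P(2Y = b)/2. -/
/-- The position after `m` steps of a ±1 random walk, where the outcome of the `i`-th
step is encoded as a `Bool` (`true ↦ +1`, `false ↦ -1`). -/
def walk {m : ℕ} (ω : Fin m → Bool) : ℤ := ∑ i, (if ω i then 1 else -1)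

/-- The probability of an event `E` over `a + b` independent fair ±1 steps, the first `a`
of which form the walk `A` and the last `b` of which form the walk `B`. -/
noncomputable def walkPr (a b : ℕ)
    (E : (Fin a → Bool) × (Fin b → Bool) → Prop) [DecidablePred E] : ℝ :=
  ((Finset.univ.filter E).card : ℝ) / 2 ^ (a + b)

/-- `binomPr n p k = C(n,k) p^k (1-p)^(n-k)`, the probability that a `Bin(n,p)` random
variable takes the value `k`. -/
def binomPr (n : ℕ) (p : ℝ) (k : ℕ) : ℝ := (n.choose k : ℝ) * p ^ k * (1 - p) ^ (n - k)

/-- Sum of `f` over the endpoints of all `n`-step walks. -/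
noncomputable def walkSum (n : ℕ) (f : ℤ → ℝ) : ℝ := ∑ ω : Fin n → Bool, f (walk ω)

theorem walkSum_zero (f : ℤ → ℝ) : walkSum 0 f = f 0 := by
  simp [walkSum, walk]

theorem walkSum_succ (n : ℕ) (f : ℤ → ℝ) :
    walkSum (n + 1) f = walkSum n (fun x => f (x + 1)) + walkSum n (fun x => f (x - 1)) := by
  unfold walkSum
  rw [← (Fin.consEquiv (fun _ : Fin (n + 1) => Bool)).sum_comp, Fintype.sum_prod_type]
  simp only [Fintype.sum_bool, Fin.consEquiv, Equiv.coe_fn_mk]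
  congr 1
  · refine Finset.sum_congr rfl fun ω _ => ?_
    congr 1
    simp [walk, Fin.sum_univ_succ]
    ring
  · refine Finset.sum_congr rfl fun ω _ => ?_
    congr 1
    simp [walk, Fin.sum_univ_succ]
    ring

theorem walkSum_add_fun (n : ℕ) (f g : ℤ → ℝ) :
    walkSum n (fun x => f x + g x) = walkSum n f + walkSum n g := by
  simp [walkSum, Finset.sum_add_distrib]

theorem walkSum_neg (n : ℕ) : ∀ f : ℤ → ℝ, walkSum n (fun x => f (-x)) = walkSum n f := by
  induction n with
  | zero => intro f; simp [walkSum_zero]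
  | succ n ih =>
    intro f
    rw [walkSum_succ, walkSum_succ, add_comm, ← ih (fun x => f (x + 1)), ← ih (fun x => f (x - 1))]
    congr 2 <;> funext x <;> congr 1 <;> ring

theorem walkSum_walkSum (b a : ℕ) : ∀ f : ℤ → ℝ,
    walkSum a (fun x => walkSum b (fun y => f (x + y))) = walkSum (a + b) f := by
  induction a with
  | zero => intro f; simp [walkSum_zero]
  | succ n ih =>
    intro f
    rw [walkSum_succ, Nat.add_right_comm, walkSum_succ, ← ih, ← ih]
    congr 2 <;> funext x <;> congr 1 <;> funext y <;> congr 1 <;> ring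

theorem walkSum_choose (n : ℕ) : ∀ f : ℤ → ℝ,
    walkSum n f = ∑ i ∈ Finset.range (n + 1), (n.choose i : ℝ) * f ((i : ℤ) - ((n - i : ℕ) : ℤ)) := by
  induction n with
  | zero => intro f; simp [walkSum_zero]
  | succ n ih =>
    intro f
    rw [walkSum_succ, ih, ih,
      Finset.sum_choose_succ_mul (fun i j => f ((i : ℤ) - (j : ℤ))) n, add_comm]
    congr 1
    · refine Finset.sum_congr rfl fun i hi => ?_
      have : i ≤ n := by simpa [Nat.lt_succ_iff] using hi
      congr 2
      omega
    · refine Finset.sum_congr rfl fun i hi => ?_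
      congr 2
      push_cast
      ring

theorem binom_half (n : ℕ) :
    (∑ i ∈ Finset.range (n + 1), if 2 * i = n then binomPr n (1 / 2) i else 0)
      = walkSum n (fun x => if x = 0 then 1 else 0) / 2 ^ n := by
  rw [walkSum_choose, Finset.sum_div]
  refine Finset.sum_congr rfl fun i hi => ?_
  have hi' : i ≤ n := by simpa [Nat.lt_succ_iff] using hi
  by_cases h : 2 * i = n
  · have h2 : (i : ℤ) - ((n - i : ℕ) : ℤ) = 0 := by omega
    rw [if_pos h, if_pos h2, binomPr]
    have : (1 - 1 / 2 : ℝ) = 1 / 2 := by norm_num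
    rw [this, mul_assoc, ← pow_add, Nat.add_sub_cancel' hi']
    simp [div_eq_mul_inv]
  · have h2 : ¬ (i : ℤ) - ((n - i : ℕ) : ℤ) = 0 := by omega
    rw [if_neg h, if_neg h2]
    simp

/-- Odd in each variable and supermodular. -/
structure GoodFun (h : ℤ → ℤ → ℝ) : Prop where
  odd1 : ∀ u v, h (-u) v = - h u v
  odd2 : ∀ u v, h u (-v) = - h u v
  sm : ∀ u u' v v', u ≤ u' → v ≤ v' → 0 ≤ h u' v' - h u' v - h u v' + h u v

theorem GoodFun.diag {h : ℤ → ℤ → ℝ} (H : GoodFun h) (c : ℤ) : 0 ≤ h c c := by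
  rcases le_total 0 c with hc | hc
  · have := H.sm (-c) c (-c) c (by omega) (by omega)
    rw [H.odd1, H.odd1, H.odd2] at this
    linarith
  · have := H.sm c (-c) c (-c) (by omega) (by omega)
    rw [H.odd1, H.odd1, H.odd2] at this
    linarith

/-- One paired step. -/
def stepFun (h : ℤ → ℤ → ℝ) (u v : ℤ) : ℝ :=
  h (u + 2) v + h (u - 2) v + h u (v + 2) + h u (v - 2)

theorem GoodFun.step {h : ℤ → ℤ → ℝ} (H : GoodFun h) : GoodFun (stepFun h) where
  odd1 u v := by
    have h1 : -u + 2 = -(u - 2) := by ring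
    have h2 : -u - 2 = -(u + 2) := by ring
    simp only [stepFun, h1, h2, H.odd1]
    ring
  odd2 u v := by
    have h1 : -v + 2 = -(v - 2) := by ring
    have h2 : -v - 2 = -(v + 2) := by ring
    simp only [stepFun, h1, h2, H.odd2]
    ring
  sm u u' v v' hu hv := by
    have h1 := H.sm (u + 2) (u' + 2) v v' (by omega) hv
    have h2 := H.sm (u - 2) (u' - 2) v v' (by omega) hv
    have h3 := H.sm u u' (v + 2) (v' + 2) hu (by omega)
    have h4 := H.sm u u' (v - 2) (v' - 2) hu (by omega)
    simp only [stepFun]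
    linarith

theorem good_walkSum_nonneg (d a : ℕ) : ∀ h : ℤ → ℤ → ℝ, GoodFun h →
    0 ≤ walkSum a (fun x => walkSum (a + d) (fun y => h (y + x) (y - x))) := by
  induction a with
  | zero =>
    intro h H
    rw [walkSum_zero]
    exact Finset.sum_nonneg fun ω _ => by simpa using H.diag (walk ω)
  | succ n ih =>
    intro h H
    have := ih _ H.step
    convert this using 1
    rw [walkSum_succ, Nat.add_right_comm, ← walkSum_add_fun]
    congr 1
    funext x
    rw [walkSum_succ, walkSum_succ, ← walkSum_add_fun, ← walkSum_add_fun, ← walkSum_add_fun]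
    congr 1
    funext y
    have e1 : y + 1 + (x + 1) = y + x + 2 := by ring
    have e2 : y + 1 - (x + 1) = y - x := by ring
    have e3 : y - 1 + (x + 1) = y + x := by ring
    have e4 : y - 1 - (x + 1) = y - x - 2 := by ring
    have e5 : y + 1 + (x - 1) = y + x := by ring
    have e6 : y + 1 - (x - 1) = y - x + 2 := by ring
    have e7 : y - 1 + (x - 1) = y + x - 2 := by ring
    have e8 : y - 1 - (x - 1) = y - x := by ring
    simp only [stepFun, e1, e2, e3, e4, e5, e6, e7, e8]
    ring

/-- Real-valued sign. -/
def rsgn (u : ℤ) : ℝ := if 0 < u then 1 else if u < 0 then -1 else 0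

theorem rsgn_neg (u : ℤ) : rsgn (-u) = - rsgn u := by
  unfold rsgn
  split_ifs <;> first | omega | simp

theorem rsgn_mono {u v : ℤ} (h : u ≤ v) : rsgn u ≤ rsgn v := by
  unfold rsgn
  split_ifs <;> first | omega | norm_num

theorem good_rsgn : GoodFun (fun u v => rsgn u * rsgn v) where
  odd1 u v := by simp [rsgn_neg]
  odd2 u v := by simp [rsgn_neg]
  sm u u' v v' hu hv := by
    have := mul_nonneg (sub_nonneg.2 (rsgn_mono hu)) (sub_nonneg.2 (rsgn_mono hv))
    linarith

theorem pointwise (x y : ℤ) :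
    2 * (if |x| < |y| then (1 : ℝ) else 0) = 1 + rsgn (y + x) * rsgn (y - x)
      - (if x + y = 0 then 1 else 0) - (if x + -y = 0 then 1 else 0)
      + (if x = 0 then 1 else 0) * (if y = 0 then 1 else 0) := by
  unfold rsgn
  rcases abs_cases x with ⟨hx, hx'⟩ | ⟨hx, hx'⟩ <;>
  rcases abs_cases y with ⟨hy, hy'⟩ | ⟨hy, hy'⟩ <;> rw [hx, hy] <;>
  split_ifs <;> first | omega | norm_num

theorem walk_abs_lt_lower_bound (a b : ℕ) (hab : a ≤ b) :
    1 / 2 - (∑ i ∈ Finset.range (a + b + 1), if 2 * i = a + b then binomPr (a + b) (1 / 2) i else 0)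
      + (∑ i ∈ Finset.range (a + 1), if 2 * i = a then binomPr a (1 / 2) i else 0) *
        (∑ j ∈ Finset.range (b + 1), if 2 * j = b then binomPr b (1 / 2) j else 0) / 2 ≤
      walkPr a b (fun ω => |walk ω.1| < |walk ω.2|) := by
  rw [binom_half, binom_half, binom_half]
  obtain ⟨g, hg⟩ : ∃ g : ℤ → ℝ, g = fun x => if x = 0 then 1 else 0 := ⟨_, rfl⟩
  rw [← hg]
  have hK : 0 ≤ walkSum a (fun x => walkSum b (fun y => rsgn (y + x) * rsgn (y - x))) := by
    obtain ⟨d, rfl⟩ := Nat.exists_eq_add_of_le hab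
    have := good_walkSum_nonneg d a (fun u v => rsgn u * rsgn v) good_rsgn
    simpa only using this
  have e1 : walkSum a (fun x => walkSum b (fun y => g (x + y))) = walkSum (a + b) g :=
    walkSum_walkSum b a g
  have e2 : walkSum a (fun x => walkSum b (fun y => g (x + -y))) = walkSum (a + b) g := by
    rw [← e1]
    congr 1
    funext x
    exact walkSum_neg b (fun y => g (x + y))
  have e3 : walkSum a (fun x => walkSum b (fun y => g x * g y)) = walkSum a g * walkSum b g := by
    simp only [walkSum, Finset.sum_mul_sum]
  have e4 : walkSum a (fun _ => walkSum b (fun _ => 1)) = 2 ^ (a + b) := by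
    simp [walkSum, pow_add]
  have hc : 2 * ((Finset.univ.filter (fun ω : (Fin a → Bool) × (Fin b → Bool) =>
      |walk ω.1| < |walk ω.2|)).card : ℝ) =
      walkSum a (fun _ => walkSum b (fun _ => 1))
      + walkSum a (fun x => walkSum b (fun y => rsgn (y + x) * rsgn (y - x)))
      - walkSum a (fun x => walkSum b (fun y => g (x + y)))
      - walkSum a (fun x => walkSum b (fun y => g (x + -y)))
      + walkSum a (fun x => walkSum b (fun y => g x * g y)) := by
    rw [Finset.card_filter, Nat.cast_sum, Fintype.sum_prod_type, Finset.mul_sum]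
    simp only [walkSum, ← Finset.sum_add_distrib, ← Finset.sum_sub_distrib, Finset.mul_sum]
    refine Finset.sum_congr rfl fun ω _ => Finset.sum_congr rfl fun ω' _ => ?_
    simp only [hg]
    rw [← pointwise]
    push_cast
    rfl
  rw [e1, e2, e3, e4] at hc
  unfold walkPr
  have hp : (0 : ℝ) < 2 ^ (a + b) := by positivity
  rw [le_div_iff₀ hp]
  have : (1 / 2 - walkSum (a + b) g / 2 ^ (a + b) +
      walkSum a g / 2 ^ a * (walkSum b g / 2 ^ b) / 2) * 2 ^ (a + b)
      = 2 ^ (a + b) / 2 - walkSum (a + b) g + walkSum a g * walkSum b g / 2 := by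
    rw [pow_add]
    field_simp
  rw [this]
  linarith
end

section
/- Let n ∈ ℕ with n ≥ 2 and let p, q be real numbers with 0 < q ≤ p ≤ 1/2 and p ≥ 1/(n+1). Let X ~ Bin(n,p) and Y ~ Bin(n,q) be independent, and let d = ⌊p(n+1)⌋ (so d ≥ 1 and d < n). Then P(X > Y) ≥ 1/2 − 1/(√(2πd)) · (1 − d/n)^(−d). -/
lemma bp_nonneg (n : ℕ) (p : ℝ) (h0 : 0 ≤ p) (h1 : p ≤ 1) (k : ℕ) : 0 ≤ binomPr n p k := by
  unfold binomPr
  have : 0 ≤ 1 - p := by linarith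
  positivity

lemma bp_zero (n : ℕ) (p : ℝ) : binomPr (n+1) p 0 = (1 - p) * binomPr n p 0 := by
  simp [binomPr, pow_succ]; ring

lemma bp_succ (n : ℕ) (p : ℝ) (j : ℕ) :
    binomPr (n+1) p (j+1) = (1 - p) * binomPr n p (j+1) + p * binomPr n p j := by
  unfold binomPr
  rw [Nat.choose_succ_succ]
  rcases lt_or_ge j n with h | h
  · obtain ⟨m, rfl⟩ : ∃ m, n = j + 1 + m := ⟨n - (j+1), by omega⟩
    have e1 : j + 1 + m + 1 - (j + 1) = m + 1 := by omega
    have e2 : j + 1 + m - (j + 1) = m := by omega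
    have e3 : j + 1 + m - j = m + 1 := by omega
    rw [e1, e2, e3]
    push_cast
    ring
  · have e : n.choose (j+1) = 0 := Nat.choose_eq_zero_of_lt (by omega)
    have e1 : n + 1 - (j + 1) = n - j := by omega
    rw [e, e1]
    push_cast
    ring

lemma cdf_succ (n : ℕ) (p : ℝ) (i : ℕ) :
    ∑ j ∈ Finset.range (i+1), binomPr (n+1) p j =
      (1 - p) * ∑ j ∈ Finset.range (i+1), binomPr n p j
        + p * ∑ j ∈ Finset.range i, binomPr n p j := by
  induction i with
  | zero => simp [bp_zero]
  | succ i ih =>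
    rw [Finset.sum_range_succ, ih, bp_succ, Finset.sum_range_succ _ (i+1),
      Finset.sum_range_succ _ i]
    ring

lemma cdf_anti (p q : ℝ) (hq0 : 0 ≤ q) (hqp : q ≤ p) (hp : p ≤ 1) (n : ℕ) : ∀ i : ℕ,
    ∑ j ∈ Finset.range i, binomPr n p j ≤ ∑ j ∈ Finset.range i, binomPr n q j := by
  induction n with
  | zero =>
    intro i
    apply Finset.sum_le_sum
    intro j _
    rcases j with _ | j <;> simp [binomPr]
  | succ n ih =>
    intro i
    rcases i with _ | i
    · simp
    rw [cdf_succ, cdf_succ]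
    have h1 := ih i
    have h2 := ih (i+1)
    have h3 : ∑ j ∈ Finset.range i, binomPr n q j ≤ ∑ j ∈ Finset.range (i+1), binomPr n q j := by
      rw [Finset.sum_range_succ]
      linarith [bp_nonneg n q hq0 (by linarith) i]
    nlinarith [mul_nonneg (sub_nonneg.2 hqp) (sub_nonneg.2 h3),
      mul_nonneg (sub_nonneg.2 hp) (sub_nonneg.2 h2),
      mul_nonneg (hq0.trans hqp) (sub_nonneg.2 h1)]

lemma bp_sum (n : ℕ) (p : ℝ) : ∑ j ∈ Finset.range (n+1), binomPr n p j = 1 := by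
  have h := add_pow p (1 - p) n
  rw [add_sub_cancel, one_pow] at h
  rw [h]
  apply Finset.sum_congr rfl
  intro j _
  unfold binomPr
  ring

lemma bp_ratio (n : ℕ) (p : ℝ) (k : ℕ) (hk : k < n) :
    binomPr n p (k+1) * ((k+1) * (1 - p)) = binomPr n p k * ((n - k) * p) := by
  unfold binomPr
  obtain ⟨m, rfl⟩ : ∃ m, n = k + 1 + m := ⟨n - (k+1), by omega⟩
  have e2 : k + 1 + m - (k + 1) = m := by omega
  have e3 : k + 1 + m - k = m + 1 := by omega
  have h := Nat.choose_succ_right_eq (k+1+m) k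
  rw [e3] at h
  have h' : ((k+1+m).choose (k+1) : ℝ) * (k+1) = (k+1+m).choose k * (m+1) := by exact_mod_cast h
  rw [e2, e3]
  push_cast
  linear_combination (p^(k+1) * (1-p)^(m+1)) * h'

lemma bp_mode (n : ℕ) (p : ℝ) (h0 : 0 < p) (h1 : p < 1) (d : ℕ) (hdn : d ≤ n)
    (hd : (d : ℝ) ≤ p * (n+1)) (hd' : p * (n+1) < d + 1) (k : ℕ) :
    binomPr n p k ≤ binomPr n p d := by
  rcases le_total k d with h | h
  · refine Nat.decreasingInduction' (P := fun k => binomPr n p k ≤ binomPr n p d) ?_ h le_rfl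
    intro k hk _ ih
    refine le_trans ?_ ih
    have hr := bp_ratio n p k (by omega)
    have hk' : (k:ℝ) + 1 ≤ d := by exact_mod_cast hk
    have hpos : 0 < ((k:ℝ)+1) * (1 - p) := mul_pos (by positivity) (by linarith)
    have hb := bp_nonneg n p h0.le h1.le k
    refine le_of_mul_le_mul_right ?_ hpos
    rw [hr]
    exact mul_le_mul_of_nonneg_left (by nlinarith) hb
  · induction k, h using Nat.le_induction with
    | base => exact le_rfl
    | succ k hk ih =>
      refine le_trans ?_ ih
      have hb := bp_nonneg n p h0.le h1.le k
      rcases lt_or_ge k n with hkn | hkn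
      · have hr := bp_ratio n p k hkn
        have hk' : (d:ℝ) ≤ k := by exact_mod_cast hk
        have hpos : 0 < ((k:ℝ)+1) * (1 - p) := mul_pos (by positivity) (by linarith)
        refine le_of_mul_le_mul_right ?_ hpos
        rw [hr]
        exact mul_le_mul_of_nonneg_left (by nlinarith) hb
      · have e : n.choose (k+1) = 0 := Nat.choose_eq_zero_of_lt (by omega)
        have : binomPr n p (k+1) = 0 := by simp [binomPr, e]
        rw [this]; exact hb

lemma pow_le_exp' (x : ℝ) (hx : 0 ≤ x) (m : ℕ) : x ^ m ≤ Real.exp (m * (x - 1)) := by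
  rw [Real.exp_nat_mul]
  exact pow_le_pow_left₀ hx (by linarith [Real.add_one_le_exp (x - 1)]) m

lemma bp_bound (n : ℕ) (p : ℝ) (h0 : 0 < p) (h1 : p < 1) (d : ℕ) (hd0 : 0 < d) (hdn : d < n) :
    binomPr n p d ≤ 1 / Real.sqrt (2 * Real.pi * d) * (1 - (d : ℝ) / n) ^ (-(d : ℤ)) := by
  have hD : (0:ℝ) < d := by exact_mod_cast hd0
  have hDN : (d:ℝ) < n := by exact_mod_cast hdn
  have hN : (0:ℝ) < n := hD.trans hDN
  set r : ℝ := 1 - (d:ℝ)/n with hr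
  have hrpos : 0 < r := by rw [hr, sub_pos, div_lt_one hN]; exact hDN
  have hc : (n.choose d : ℝ) ≤ (n:ℝ)^d / d.factorial := Nat.choose_le_pow_div d n
  have hs := Stirling.le_factorial_stirling d
  have hS : 0 < Real.sqrt (2 * Real.pi * d) := Real.sqrt_pos.2 (by positivity)
  have hde : 0 < ((d:ℝ) / Real.exp 1)^d := by positivity
  have hc2 : (n.choose d : ℝ) ≤ (n:ℝ)^d / (Real.sqrt (2 * Real.pi * d) * ((d:ℝ) / Real.exp 1)^d) :=
    hc.trans (div_le_div_of_nonneg_left (by positivity) (by positivity) hs)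
  -- AM-GM step
  have ha := pow_le_exp' (n * p / d) (by positivity) d
  have hq : 0 < 1 - p := by linarith
  have hb := pow_le_exp' ((1-p) / r) (by positivity) (n-d)
  have hg := pow_le_exp' r hrpos.le n
  have e1 : (d:ℝ) * (n * p / d - 1) = n * p - d := by field_simp
  have hnr : (n:ℝ) * r = n - d := by rw [hr]; field_simp
  have e2 : ((n-d : ℕ):ℝ) * ((1-p)/r - 1) = d - n * p := by
    rw [Nat.cast_sub hdn.le, ← hnr]; field_simp; rw [hr]; field_simp; ring
  have e3 : (n:ℝ) * (r - 1) = -d := by rw [hr]; field_simp; ring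
  rw [e1] at ha
  rw [e2] at hb
  rw [e3] at hg
  have hab : (n * p / d)^d * ((1-p)/r)^(n-d) ≤ 1 := by
    calc _ ≤ Real.exp (n*p-d) * Real.exp (d - n*p) := by gcongr
      _ = 1 := by rw [← Real.exp_add]; simp
  have key : (n * p / d)^d * Real.exp 1 ^ d * (1-p)^(n-d) * r^d ≤ 1 := by
    have e4 : (1-p)^(n-d) * r^d = ((1-p)/r)^(n-d) * r^n := by
      rw [div_pow, ← Nat.sub_add_cancel hdn.le, pow_add, Nat.sub_add_cancel hdn.le]
      field_simp
    calc _ = ((n * p / d)^d * ((1-p)/r)^(n-d)) * (Real.exp 1 ^ d * r^n) := by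
          rw [mul_assoc _ ((1-p)^(n-d)), e4]; ring
      _ ≤ 1 * (Real.exp 1 ^ d * Real.exp (-d)) := by gcongr
      _ = 1 := by rw [← Real.exp_nat_mul, ← Real.exp_add]; simp
  rw [zpow_neg, zpow_natCast]
  calc binomPr n p d ≤ (n:ℝ)^d / (Real.sqrt (2 * Real.pi * d) * ((d:ℝ) / Real.exp 1)^d)
        * p^d * (1-p)^(n-d) := by unfold binomPr; gcongr
    _ = 1 / Real.sqrt (2 * Real.pi * d) * (((n * p / d)^d * Real.exp 1 ^ d * (1-p)^(n-d) * r^d)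
        * (r^d)⁻¹) := by
        simp only [div_pow, mul_pow]; field_simp
    _ ≤ 1 / Real.sqrt (2 * Real.pi * d) * (1 * (r^d)⁻¹) := by gcongr
    _ = _ := by rw [one_mul]

lemma sum_sq (N : ℕ) (f : ℕ → ℝ) :
    (∑ j ∈ Finset.range N, f j)^2 =
      2 * (∑ i ∈ Finset.range N, ∑ j ∈ Finset.range N, (if j < i then f i * f j else 0))
        + ∑ i ∈ Finset.range N, f i * f i := by
  have h1 : ∑ i ∈ Finset.range N, f i * f i =
      ∑ i ∈ Finset.range N, ∑ j ∈ Finset.range N, (if i = j then f i * f j else 0) := by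
    apply Finset.sum_congr rfl
    intro i hi
    rw [Finset.sum_ite_eq, if_pos hi]
  have h2 : ∑ i ∈ Finset.range N, ∑ j ∈ Finset.range N, (if j < i then f i * f j else 0) =
      ∑ i ∈ Finset.range N, ∑ j ∈ Finset.range N, (if i < j then f i * f j else 0) := by
    rw [Finset.sum_comm]
    simp only [mul_comm]
  rw [two_mul]
  nth_rewrite 2 [h2]
  rw [h1, sq, Finset.sum_mul_sum, ← Finset.sum_add_distrib, ← Finset.sum_add_distrib]
  apply Finset.sum_congr rfl
  intro i _
  rw [← Finset.sum_add_distrib, ← Finset.sum_add_distrib]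
  apply Finset.sum_congr rfl
  intro j _
  rcases lt_trichotomy i j with h | h | h
  · simp [h, h.not_gt, h.ne]
  · simp [h]
  · simp [h, h.not_gt, h.ne']

/-- Let `n ≥ 2`, `0 < q ≤ p ≤ 1/2` with `p ≥ 1/(n+1)`, let
`X ~ Bin(n,p)` and `Y ~ Bin(n,q)` be independent, and let `d = ⌊p(n+1)⌋`.  Then
`P(X > Y) ≥ 1/2 − 1/√(2πd) · (1 − d/n)^(−d)`.  The probability `P(X > Y)` is written
out as the sum of the joint (product) probabilities over all pairs of outcomes with
`i > j`. -/
theorem binomial_strict_domination (n : ℕ) (hn : 2 ≤ n) (p q : ℝ)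
    (hq0 : 0 < q) (hqp : q ≤ p) (hp : p ≤ 1 / 2) (hpn : 1 / (n + 1 : ℝ) ≤ p)
    (d : ℕ) (hd : d = ⌊p * (n + 1)⌋₊) :
    1 / 2 - 1 / Real.sqrt (2 * Real.pi * d) * (1 - (d : ℝ) / n) ^ (-(d : ℤ)) ≤
      ∑ i ∈ Finset.range (n + 1), ∑ j ∈ Finset.range (n + 1),
        (if j < i then binomPr n p i * binomPr n q j else 0) := by
  have hN : (2:ℝ) ≤ n := by exact_mod_cast hn
  have hp0 : 0 < p := hq0.trans_le hqp
  have hp1 : p < 1 := by linarith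
  have hd1 : (d:ℝ) ≤ p * (n+1) := by rw [hd]; exact Nat.floor_le (by positivity)
  have hd2 : p * (n+1) < d + 1 := by rw [hd]; exact Nat.lt_floor_add_one _
  have hd0 : 0 < d := by
    rw [hd, Nat.floor_pos]
    rwa [div_le_iff₀ (by positivity)] at hpn
  have hdn : d < n := by
    have : (d:ℝ) < n := by nlinarith
    exact_mod_cast this
  have hmono : ∑ i ∈ Finset.range (n + 1), ∑ j ∈ Finset.range (n + 1),
        (if j < i then binomPr n p i * binomPr n p j else 0) ≤
      ∑ i ∈ Finset.range (n + 1), ∑ j ∈ Finset.range (n + 1),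
        (if j < i then binomPr n p i * binomPr n q j else 0) := by
    apply Finset.sum_le_sum
    intro i hi
    have hi' : i < n + 1 := Finset.mem_range.1 hi
    have hf : (Finset.range (n+1)).filter (fun j => j < i) = Finset.range i := by
      ext j; simp; omega
    rw [← Finset.sum_filter, ← Finset.sum_filter, hf, ← Finset.mul_sum, ← Finset.mul_sum]
    exact mul_le_mul_of_nonneg_left (cdf_anti p q hq0.le hqp hp1.le n i)
      (bp_nonneg n p hp0.le hp1.le i)
  have hsq := sum_sq (n+1) (binomPr n p)
  rw [bp_sum] at hsq
  have hdiag : ∑ i ∈ Finset.range (n+1), binomPr n p i * binomPr n p i ≤ binomPr n p d := by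
    calc _ ≤ ∑ i ∈ Finset.range (n+1), binomPr n p i * binomPr n p d := by
          apply Finset.sum_le_sum
          intro i _
          exact mul_le_mul_of_nonneg_left (bp_mode n p hp0 hp1 d hdn.le hd1 hd2 i)
            (bp_nonneg n p hp0.le hp1.le i)
      _ = _ := by rw [← Finset.sum_mul, bp_sum, one_mul]
  have hB := bp_bound n p hp0 hp1 d hd0 hdn
  have hB0 := bp_nonneg n p hp0.le hp1.le d
  linarith
end
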